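/- Let N ≥ 2 be a natural number and f(N) = 3N(N+1)/(2N+1). Let p : Fin m → ℝ with pᵢ ≥ 0 for all i and ∑ᵢ pᵢ = 1, and suppose there exist indices i, j with pᵢ > 0, pⱼ > 0 and pᵢ ≠ pⱼ. Then there exist m' and q : Fin m' → ℝ with qᵢ ≥ 0, ∑ᵢ qᵢ = 1, and 1 − 3∑ᵢ qᵢ² + f(N)∑ᵢ qᵢ³ < 1 − 3∑ᵢ pᵢ² + f(N)∑ᵢ pᵢ³. Hence among distributions summing to 1, L_N can only be minimized at uniform distributions. (Lemma 3.5.) -/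

import Mathlib

/-- The functional `1 - 3 ∑ pᵢ² + f ∑ pᵢ³`. -/
noncomputable def cubicFunctional (f : ℝ) {m : ℕ} (p : Fin m → ℝ) : ℝ :=
  1 - 3 * ∑ i, p i ^ 2 + f * ∑ i, p i ^ 3

theorem sum_comp_update_update {ι : Type*} [Fintype ι] [DecidableEq ι] (g : ℝ → ℝ) (p : ι → ℝ)
    {i j : ι} (hij : i ≠ j) (x y : ℝ) :
    ∑ k, g (Function.update (Function.update p i x) j y k) =
      ∑ k, g (p k) - g (p i) - g (p j) + g x + g y := by
  have key (h : ι → ℝ) : ∑ k, h k = h j + (h i + ∑ k ∈ (Finset.univ.erase j).erase i, h k) := by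
    rw [Finset.add_sum_erase _ _ (by simp [hij]), Finset.add_sum_erase _ _ (by simp)]
  rw [key, key fun k => g (p k)]
  have hrest : ∑ k ∈ (Finset.univ.erase j).erase i,
      g (Function.update (Function.update p i x) j y k) =
      ∑ k ∈ (Finset.univ.erase j).erase i, g (p k) := by
    refine Finset.sum_congr rfl fun k hk => ?_
    simp only [Finset.mem_erase, Finset.mem_univ, and_true] at hk
    simp [Function.update_of_ne hk.1, Function.update_of_ne hk.2]
  rw [hrest]
  simp [Function.update_of_ne hij]
  ring

/-- Redistributing the mass of two atoms changes the functional by a multiple of the change in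
their product. -/
theorem exists_redistribute (f : ℝ) {m : ℕ} (p : Fin m → ℝ) (hnn : ∀ k, 0 ≤ p k) {i j : Fin m}
    (hij : i ≠ j) {x y : ℝ} (hx : 0 ≤ x) (hy : 0 ≤ y) (hxy : x + y = p i + p j) :
    ∃ q : Fin m → ℝ, (∀ k, 0 ≤ q k) ∧ ∑ k, q k = ∑ k, p k ∧ q i = x ∧
      (∀ k, k ≠ i → k ≠ j → q k = p k) ∧
      cubicFunctional f q =
        cubicFunctional f p + (x * y - p i * p j) * (6 - 3 * (f * (p i + p j))) := by
  refine ⟨Function.update (Function.update p i x) j y, fun k => ?_, ?_, ?_, fun k hi hj => ?_, ?_⟩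
  · simp only [Function.update_apply]
    split_ifs
    exacts [hy, hx, hnn k]
  · have := sum_comp_update_update id p hij x y
    simp only [id] at this
    linarith
  · simp [Function.update_of_ne hij]
  · simp [Function.update_of_ne hi, Function.update_of_ne hj]
  · have h2 := sum_comp_update_update (· ^ 2) p hij x y
    have h3 := sum_comp_update_update (· ^ 3) p hij x y
    obtain rfl : y = p i + p j - x := by linarith
    rw [cubicFunctional, cubicFunctional, h2, h3]
    ring

theorem exists_cubicFunctional_lt_of_two_lt (f : ℝ) {m : ℕ} (p : Fin m → ℝ)
    (hnn : ∀ k, 0 ≤ p k) {i j : Fin m} (hij : p i ≠ p j) (hf : 2 < f * (p i + p j)) :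
    ∃ q : Fin m → ℝ, (∀ k, 0 ≤ q k) ∧ ∑ k, q k = ∑ k, p k ∧
      cubicFunctional f q < cubicFunctional f p := by
  have hmean : 0 ≤ (p i + p j) / 2 := by linarith [hnn i, hnn j]
  obtain ⟨q, hq, hs, -, -, hL⟩ := exists_redistribute f p hnn (ne_of_apply_ne p hij) hmean hmean
    (by ring)
  refine ⟨q, hq, hs, ?_⟩
  have hsq : 0 < (p i - p j) ^ 2 := by positivity [sub_ne_zero.2 hij]
  have hprod : 0 < (p i + p j) / 2 * ((p i + p j) / 2) - p i * p j := by linarith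
  nlinarith

theorem exists_cubicFunctional_lt {f : ℝ} (hf : 2 < f) {m : ℕ} (p : Fin m → ℝ)
    (hnn : ∀ k, 0 ≤ p k) (hsum : ∑ k, p k = 1) {i j : Fin m} (hi : 0 < p i) (hj : 0 < p j)
    (hij : p i ≠ p j) :
    ∃ q : Fin m → ℝ, (∀ k, 0 ≤ q k) ∧ ∑ k, q k = ∑ k, p k ∧
      cubicFunctional f q < cubicFunctional f p := by
  have hne : i ≠ j := ne_of_apply_ne p hij
  obtain ⟨q, hq, hs, hqi, hrest, hL⟩ := exists_redistribute f p hnn hne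
    (add_nonneg hi.le hj.le) le_rfl (add_zero _)
  rcases lt_trichotomy (f * (p i + p j)) 2 with h | h | h
  · refine ⟨q, hq, hs, ?_⟩
    nlinarith [mul_pos hi hj]
  · obtain ⟨k, hki, hkj, hk⟩ : ∃ k, k ≠ i ∧ k ≠ j ∧ 0 < p k := by
      by_contra! hcon
      have : ∑ k, p k = p i + p j :=
        Fintype.sum_eq_add i j hne fun k hk => (hcon k hk.1 hk.2).antisymm (hnn k)
      rw [← this, hsum] at h
      linarith
    have hfk : 0 < f * p k := by positivity
    have hfi : 0 < f * p i := by positivity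
    by_cases hc : p i + p j = p k
    · refine exists_cubicFunctional_lt_of_two_lt f p hnn (i := i) (j := k) (by linarith) ?_
      rw [← hc]
      linarith
    · have hqk := hrest k hki hkj
      obtain ⟨r, hr, hrs, hrL⟩ := exists_cubicFunctional_lt_of_two_lt f q hq (i := i) (j := k)
        (by rwa [hqi, hqk]) (by rw [hqi, hqk]; linarith)
      refine ⟨r, hr, hrs.trans hs, ?_⟩
      rw [h] at hL
      linarith
  · exact exists_cubicFunctional_lt_of_two_lt f p hnn hij h

theorem LN_not_minimized_at_nonuniform (N : ℕ) (hN : 2 ≤ N) (m : ℕ) (p : Fin m → ℝ)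
    (hnn : ∀ i, 0 ≤ p i) (hsum : ∑ i, p i = 1)
    (i j : Fin m) (hi : 0 < p i) (hj : 0 < p j) (hij : p i ≠ p j) :
    ∃ (m' : ℕ) (q : Fin m' → ℝ), (∀ i, 0 ≤ q i) ∧ ∑ i, q i = 1 ∧
      1 - 3 * ∑ i, q i ^ 2 + 3 * (N : ℝ) * (N + 1) / (2 * N + 1) * ∑ i, q i ^ 3 <
        1 - 3 * ∑ i, p i ^ 2 + 3 * (N : ℝ) * (N + 1) / (2 * N + 1) * ∑ i, p i ^ 3 := by
  have hN' : (2 : ℝ) ≤ N := by exact_mod_cast hN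
  have hf : 2 < 3 * (N : ℝ) * (N + 1) / (2 * N + 1) := by
    rw [lt_div_iff₀ (by positivity)]
    nlinarith
  obtain ⟨q, hq, hs, hL⟩ := exists_cubicFunctional_lt hf p hnn hsum hi hj hij
  exact ⟨m, q, hq, hs.trans hsum, hL⟩
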